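/- arXiv:2512.17837 — 7 statements merged into one kernel-verified Lean document; each statement's English description precedes it below -/
import Mathlib

section
/- Trace inequality on a domain with a rough lower graph boundary: let omega be an open bounded subset of R^2, a > 0, and let g: R^2 -> R be differentiable with g(x') >= 0 for all x' in omega. Define Omega = {(x', x3) in R^2 x R : x' in omega, -g(x') < x3 < a}, tau = sup_{x' in omega} sqrt(1 + |grad g(x')|^2) and H = sup_{x' in omega} (a + g(x')), assumed finite. Then every continuously differentiable vector field psi: R^3 -> R^3 satisfying psi(x', a) = 0 for all x' in omega obeys the inequality: integral over omega of |psi(x', -g(x'))|^2 * sqrt(1 + |grad g(x')|^2) dx' <= tau * H * integral over Omega of |D psi(x)|^2 dx, where |D psi|^2 is the squared Frobenius norm of the Jacobian of psi. -/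
open MeasureTheory

/-- Cauchy–Schwarz against the constant function `1` on an interval. -/
theorem sq_intervalIntegral_le {v : ℝ → ℝ} (hv : Continuous v) {b a : ℝ} (hab : b < a) :
    (∫ t in b..a, v t) ^ 2 ≤ (a - b) * ∫ t in b..a, v t ^ 2 := by
  set c := ∫ t in b..a, v t with hc
  have hL : 0 < a - b := sub_pos.2 hab
  have hnonneg : 0 ≤ ∫ t in b..a, ((a - b) * v t - c) ^ 2 :=
    intervalIntegral.integral_nonneg hab.le fun _ _ => sq_nonneg _
  have hexpand : ∫ t in b..a, ((a - b) * v t - c) ^ 2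
      = (a - b) * ((a - b) * (∫ t in b..a, v t ^ 2) - c ^ 2) := by
    have hpt : ∀ t, ((a - b) * v t - c) ^ 2
        = (a - b) ^ 2 * v t ^ 2 - 2 * (a - b) * c * v t + c ^ 2 := fun t => by ring
    simp only [hpt]
    rw [intervalIntegral.integral_add, intervalIntegral.integral_sub,
      intervalIntegral.integral_const_mul, intervalIntegral.integral_const_mul,
      intervalIntegral.integral_const, ← hc, smul_eq_mul]
    · ring
    all_goals exact Continuous.intervalIntegrable (by fun_prop) _ _
  rw [hexpand] at hnonneg
  linarith [nonneg_of_mul_nonneg_right hnonneg hL]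

/-- A `C¹` function vanishing at the top of a vertical segment is controlled at the bottom by the
integral of its squared vertical derivative. -/
theorem sq_le_integral_sq_fderiv_vertical {E : Type*} [NormedAddCommGroup E] [NormedSpace ℝ E]
    {u : E × ℝ → ℝ} (hu : ContDiff ℝ 1 u) {x : E} {b a : ℝ} (hab : b < a) (h0 : u (x, a) = 0) :
    u (x, b) ^ 2 ≤ (a - b) * ∫ t in b..a, (fderiv ℝ u (x, t) (0, 1)) ^ 2 := by
  have hcont : Continuous fun t : ℝ => fderiv ℝ u (x, t) (0, 1) :=
    ((hu.continuous_fderiv one_ne_zero).comp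
      (by fun_prop : Continuous fun t : ℝ => (x, t))).clm_apply
      continuous_const
  have hderiv : ∀ t : ℝ, HasDerivAt (fun s => u (x, s)) (fderiv ℝ u (x, t) (0, 1)) t := fun t =>
    ((hu.differentiable one_ne_zero) (x, t)).hasFDerivAt.comp_hasDerivAt t
      ((hasDerivAt_const t x).prodMk (hasDerivAt_id t))
  have hftc := intervalIntegral.integral_eq_sub_of_hasDerivAt (a := b) (b := a)
    (fun t _ => hderiv t) (hcont.intervalIntegrable _ _)
  have hcs := sq_intervalIntegral_le hcont hab
  rw [hftc, h0, zero_sub, neg_sq] at hcs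
  exact hcs

/-- Trace inequality on a domain with a rough lower graph boundary:
for a continuously differentiable vector field `ψ` vanishing on the upper boundary
`{x₃ = a}`, the `L²`-norm of its trace on the lower boundary `{x₃ = -g(x')}`
(computed with the surface measure `√(1+|∇g|²) dx'`) is controlled by
`τ · H` times the `L²`-norm of the full Jacobian over the domain. -/
theorem trace_inequality_rough_boundary
    (ω : Set (ℝ × ℝ)) (hω : IsOpen ω) (hωb : Bornology.IsBounded ω)
    (a : ℝ) (ha : 0 < a)
    (g : ℝ × ℝ → ℝ) (hg : Differentiable ℝ g)
    (hg0 : ∀ x' ∈ ω, 0 ≤ g x')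
    (τ H : ℝ)
    (hτ : ∀ x' ∈ ω,
      Real.sqrt (1 + ((fderiv ℝ g x') (1, 0)) ^ 2 + ((fderiv ℝ g x') (0, 1)) ^ 2) ≤ τ)
    (hH : ∀ x' ∈ ω, a + g x' ≤ H)
    (ψ : (ℝ × ℝ) × ℝ → Fin 3 → ℝ) (hψ : ContDiff ℝ 1 ψ)
    (hψ0 : ∀ x' ∈ ω, ψ (x', a) = 0) :
    (∫ x' in ω, (∑ i : Fin 3, (ψ (x', -g x') i) ^ 2) *
        Real.sqrt (1 + ((fderiv ℝ g x') (1, 0)) ^ 2 + ((fderiv ℝ g x') (0, 1)) ^ 2))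
      ≤ τ * H * ∫ x in {p : (ℝ × ℝ) × ℝ | p.1 ∈ ω ∧ -g p.1 < p.2 ∧ p.2 < a},
          ∑ i : Fin 3,
            ((fderiv ℝ (fun y => ψ y i) x ((1, 0), 0)) ^ 2
              + (fderiv ℝ (fun y => ψ y i) x ((0, 1), 0)) ^ 2
              + (fderiv ℝ (fun y => ψ y i) x ((0, 0), 1)) ^ 2) := by
  rcases ω.eq_empty_or_nonempty with rfl | ⟨x₀, hx₀⟩
  · simp
  have hτ0 : 0 ≤ τ := (Real.sqrt_nonneg _).trans (hτ x₀ hx₀)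
  have hH0 : 0 ≤ H := by linarith [hH x₀ hx₀, hg0 x₀ hx₀]
  have hψi : ∀ i, ContDiff ℝ 1 fun y => ψ y i := fun i => contDiff_pi.1 hψ i
  have hpartial : ∀ (i : Fin 3) (v : (ℝ × ℝ) × ℝ),
      Continuous fun x => fderiv ℝ (fun y => ψ y i) x v := fun i v =>
    ((hψi i).continuous_fderiv one_ne_zero).clm_apply continuous_const
  set J : (ℝ × ℝ) × ℝ → ℝ := fun x => ∑ i : Fin 3,
    ((fderiv ℝ (fun y => ψ y i) x ((1, 0), 0)) ^ 2
      + (fderiv ℝ (fun y => ψ y i) x ((0, 1), 0)) ^ 2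
      + (fderiv ℝ (fun y => ψ y i) x ((0, 0), 1)) ^ 2) with hJ
  have hJcont : Continuous J := continuous_finsetSum _ fun i _ =>
    (((hpartial i _).pow 2).add ((hpartial i _).pow 2)).add ((hpartial i _).pow 2)
  set Ω : Set ((ℝ × ℝ) × ℝ) := {p | p.1 ∈ ω ∧ -g p.1 < p.2 ∧ p.2 < a} with hΩ
  have hΩm : MeasurableSet Ω :=
    measurableSet_regionBetween hg.continuous.measurable.neg measurable_const hω.measurableSet
  have hΩb : Bornology.IsBounded Ω := by
    refine (hωb.prod (Metric.isBounded_Icc (a - H) a)).subset ?_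
    rintro ⟨x, t⟩ ⟨hx, h1, h2⟩
    exact ⟨hx, by linarith [hH x hx], h2.le⟩
  have hJint : IntegrableOn J Ω :=
    (hJcont.continuousOn.integrableOn_compact hΩb.isCompact_closure).mono_set subset_closure
  have hFint : Integrable (Ω.indicator J) ((volume : Measure (ℝ × ℝ)).prod volume) :=
    (integrable_indicator_iff hΩm).2 hJint
  have hslice : ∀ x ∈ ω, ∫ t, Ω.indicator J (x, t) = ∫ t in -g x..a, J (x, t) := by
    intro x hx
    rw [intervalIntegral.integral_of_le (by linarith [hg0 x hx]), integral_Ioc_eq_integral_Ioo,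
      ← integral_indicator measurableSet_Ioo]
    refine integral_congr_ae (.of_forall fun t => ?_)
    simp [Set.indicator, hΩ, hx]
  have hfubini : ∫ x in Ω, J x = ∫ x in ω, ∫ t, Ω.indicator J (x, t) := by
    rw [← integral_indicator hΩm, Measure.volume_eq_prod, integral_prod _ hFint]
    refine (setIntegral_eq_integral_of_forall_compl_eq_zero fun x hx => ?_).symm
    simp [Set.indicator, hΩ, hx]
  rw [hfubini, ← integral_const_mul]
  refine integral_mono_of_nonneg (.of_forall fun x => by positivity)
    (hFint.integral_prod_left.integrableOn.const_mul _) ?_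
  filter_upwards [ae_restrict_mem hω.measurableSet] with x hx
  have hab : -g x < a := by linarith [hg0 x hx]
  have hJslice : Continuous fun t : ℝ => J (x, t) := hJcont.comp (by fun_prop)
  have hvert : ∀ i, Continuous fun t : ℝ => (fderiv ℝ (fun y => ψ y i) (x, t) (0, 1)) ^ 2 :=
    fun i => ((hpartial i _).comp (by fun_prop : Continuous fun t : ℝ => (x, t))).pow 2
  have hJnonneg : 0 ≤ ∫ t in -g x..a, J (x, t) :=
    intervalIntegral.integral_nonneg hab.le fun t _ => by simp only [hJ]; positivity
  have htrace : ∑ i, ψ (x, -g x) i ^ 2 ≤ H * ∫ t in -g x..a, J (x, t) := by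
    calc ∑ i, ψ (x, -g x) i ^ 2
        ≤ ∑ i, (a - -g x) * ∫ t in -g x..a, (fderiv ℝ (fun y => ψ y i) (x, t) (0, 1)) ^ 2 :=
          Finset.sum_le_sum fun i _ =>
            sq_le_integral_sq_fderiv_vertical (hψi i) hab (by simp [hψ0 x hx])
      _ = (a - -g x) * ∫ t in -g x..a,
            ∑ i, (fderiv ℝ (fun y => ψ y i) (x, t) (0, 1)) ^ 2 := by
          rw [← Finset.mul_sum, intervalIntegral.integral_finsetSum]
          exact fun i _ => (hvert i).intervalIntegrable _ _
      _ ≤ (a - -g x) * ∫ t in -g x..a, J (x, t) := by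
          refine mul_le_mul_of_nonneg_left ?_ (by linarith)
          refine intervalIntegral.integral_mono_on hab.le
            ((continuous_finsetSum _ fun i _ => hvert i).intervalIntegrable _ _)
            (hJslice.intervalIntegrable _ _) fun t _ => Finset.sum_le_sum fun i _ => ?_
          exact le_add_of_nonneg_left (by positivity)
      _ ≤ H * ∫ t in -g x..a, J (x, t) :=
          mul_le_mul_of_nonneg_right (by linarith [hH x hx]) hJnonneg
  rw [hslice x hx]
  calc _ ≤ (H * ∫ t in -g x..a, J (x, t)) * τ :=
        mul_le_mul htrace (hτ x hx) (Real.sqrt_nonneg _) (mul_nonneg hH0 hJnonneg)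
    _ = _ := by ring
end

section
/- Equivalence of the rotational and Jacobian forms of the tangential boundary condition on a flat boundary: let n be a vector in R^3, c a real number, and let P = {x in R^3 : x . n = c} be the corresponding affine plane. Let u: R^3 -> R^3 be differentiable at a point x0 in P and suppose u(x) . n = 0 for every x in P. Then for every vector v in R^3 with v . n = 0, one has ((curl u)(x0) x n) . v = (D u(x0) n) . v, where D u(x0) is the Jacobian matrix of u at x0 and x denotes the vector cross product. In particular, since v is tangent, the right-hand side equals the tangential part [D u(x0) n]_tan dotted with v, so the boundary condition (curl u) x n = (expression) tested against tangential fields coincides with [D u n]_tan = (expression) on a flat boundary. -/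
open Matrix

/-- The component along `n` of a differentiable map that vanishes against `n` on a hyperplane
orthogonal to `n` has zero derivative in the directions tangent to that hyperplane. -/
theorem fderiv_dotProduct_eq_zero_of_dotProduct_eq_zero_on_hyperplane
    {ι : Type*} [Fintype ι] {n : ι → ℝ} {c : ℝ} {u : (ι → ℝ) → (ι → ℝ)} {x₀ : ι → ℝ}
    (hx₀ : x₀ ⬝ᵥ n = c) (hu : DifferentiableAt ℝ u x₀)
    (hun : ∀ x : ι → ℝ, x ⬝ᵥ n = c → u x ⬝ᵥ n = 0) {v : ι → ℝ} (hv : v ⬝ᵥ n = 0) :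
    fderiv ℝ u x₀ v ⬝ᵥ n = 0 := by
  have h_line : HasDerivAt (fun t : ℝ => u (x₀ + t • v)) (fderiv ℝ u x₀ v) 0 :=
    hu.hasFDerivAt.hasLineDerivAt v
  have h_dot : HasDerivAt (fun t : ℝ => u (x₀ + t • v) ⬝ᵥ n) (fderiv ℝ u x₀ v ⬝ᵥ n) 0 :=
    HasDerivAt.fun_sum fun i _ => (hasDerivAt_pi.1 h_line i).mul_const (n i)
  have h_zero : (fun t : ℝ => u (x₀ + t • v) ⬝ᵥ n) = fun _ => 0 := by
    funext t
    exact hun _ (by simp [add_dotProduct, smul_dotProduct, hx₀, hv])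
  rw [h_zero] at h_dot
  exact h_dot.unique (hasDerivAt_const 0 0)

/-- The antisymmetric part of a linear map `L` on `ℝ³` acts as the cross product with its curl:
`(curl L × n) ⬝ v = (L n) ⬝ v - (L v) ⬝ n`. -/
theorem curl_crossProduct_dotProduct (L : (Fin 3 → ℝ) →ₗ[ℝ] (Fin 3 → ℝ)) (n v : Fin 3 → ℝ) :
    (crossProduct
      ![L (Pi.single 1 1) 2 - L (Pi.single 2 1) 1,
        L (Pi.single 2 1) 0 - L (Pi.single 0 1) 2,
        L (Pi.single 0 1) 1 - L (Pi.single 1 1) 0]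
      n) ⬝ᵥ v = L n ⬝ᵥ v - L v ⬝ᵥ n := by
  have h_expand (w : Fin 3 → ℝ) (i : Fin 3) : L w i =
      w 0 * L (Pi.single 0 1) i + w 1 * L (Pi.single 1 1) i + w 2 * L (Pi.single 2 1) i := by
    have h_sum : w = w 0 • Pi.single 0 1 + w 1 • Pi.single 1 1 + w 2 • Pi.single 2 1 := by
      ext j
      fin_cases j <;> simp
    conv_lhs => rw [h_sum]
    simp only [map_add, map_smul, Pi.add_apply, Pi.smul_apply, smul_eq_mul]
  simp only [cross_apply, dotProduct, Fin.sum_univ_three, h_expand n, h_expand v]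
  simp
  ring

/-- Equivalence of the rotational and Jacobian forms of the tangential boundary
condition on a flat boundary: if `u : ℝ³ → ℝ³` is differentiable at a point `x₀`
of the affine plane `P = {x : x ⬝ n = c}` and satisfies `u(x) ⬝ n = 0` on `P`,
then for every tangent vector `v` (`v ⬝ n = 0`) one has
`((curl u)(x₀) × n) ⬝ v = (Du(x₀) n) ⬝ v`. -/
theorem curl_cross_normal_eq_jacobian_normal_on_flat_boundary
    (n : Fin 3 → ℝ) (c : ℝ)
    (u : (Fin 3 → ℝ) → (Fin 3 → ℝ)) (x0 : Fin 3 → ℝ)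
    (hx0 : x0 ⬝ᵥ n = c)
    (hu : DifferentiableAt ℝ u x0)
    (hun : ∀ x : Fin 3 → ℝ, x ⬝ᵥ n = c → (u x) ⬝ᵥ n = 0)
    (v : Fin 3 → ℝ) (hv : v ⬝ᵥ n = 0) :
    (crossProduct
      ![fderiv ℝ u x0 (Pi.single 1 1) 2 - fderiv ℝ u x0 (Pi.single 2 1) 1,
        fderiv ℝ u x0 (Pi.single 2 1) 0 - fderiv ℝ u x0 (Pi.single 0 1) 2,
        fderiv ℝ u x0 (Pi.single 0 1) 1 - fderiv ℝ u x0 (Pi.single 1 1) 0]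
      n) ⬝ᵥ v = (fderiv ℝ u x0 n) ⬝ᵥ v := by
  have h_tan : fderiv ℝ u x0 v ⬝ᵥ n = 0 :=
    fderiv_dotProduct_eq_zero_of_dotProduct_eq_zero_on_hyperplane hx0 hu hun hv
  have h_curl := curl_crossProduct_dotProduct (fderiv ℝ u x0 : (Fin 3 → ℝ) →ₗ[ℝ] _) n v
  simpa only [ContinuousLinearMap.coe_coe, h_tan, sub_zero] using h_curl
end

section
/- Lemma A.3 (explicit solution of the limit micropolar system in the super-critical case): with the data of the context (constants N, R_c, h, the derived quantities k, L'', A'', B'', and the functions u, w built from a differentiable pressure p), the pair (u, w) satisfies, at every (y1, y3) in (0,1) x (0,h): (i) -d^2 u/d y3^2 + p'(y1) + 2 N^2 * d w/d y3 = 0; (ii) -R_c * d^2 w/d y3^2 + 4 N^2 * w - 2 N^2 * d u/d y3 = 0; (iii) u(y1, h) = 0 and w(y1, h) = 0; (iv) u(y1, 0) = 0; (v) d w/d y3 (y1, 0) = 0. -/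
/-- The derivative of a combination of `sinh (k y)`, `cosh (k y)` and a quadratic polynomial
is again such a combination. -/
theorem deriv_sinh_add_cosh_add_quadratic (k a b c d e : ℝ) :
    deriv (fun y : ℝ => a * Real.sinh (k * y) + b * Real.cosh (k * y) + c * y ^ 2 + d * y + e)
      = fun y => (k * b) * Real.sinh (k * y) + (k * a) * Real.cosh (k * y)
          + 0 * y ^ 2 + (2 * c) * y + d := by
  funext y
  have hky : HasDerivAt (fun y : ℝ => k * y) k y := by
    simpa using (hasDerivAt_id y).const_mul k
  have hpoly : HasDerivAt (fun y : ℝ => c * y ^ 2) (c * (2 * y)) y := by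
    simpa using (hasDerivAt_pow 2 y).const_mul c
  have hlin : HasDerivAt (fun y : ℝ => d * y) d y := by
    simpa using (hasDerivAt_id y).const_mul d
  have hsum := ((((hky.sinh.const_mul a).add (hky.cosh.const_mul b)).add hpoly).add hlin).add_const e
  refine HasDerivAt.deriv (hsum.congr_deriv ?_)
  ring

/-- Lemma A.3: explicit solution of the limit micropolar system in the
super-critical case.  The explicitly given pair `(u, w)` satisfies the limit
micropolar ODE system in `(0,1) × (0,h)` together with the boundary conditions
`u = w = 0` on `y₃ = h`, `u = 0` on `y₃ = 0` and `∂w/∂y₃ = 0` on `y₃ = 0`. -/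
theorem micropolar_explicit_solution_supercritical
    (N R_c h : ℝ)
    (hN0 : 0 < N) (hN1 : N < 1) (hRc : 0 < R_c) (hh : 0 < h)
    (k L A B : ℝ)
    (hk : k = 2 * N * Real.sqrt ((1 - N ^ 2) / R_c))
    (hLden : Real.cosh (k * h) - (N ^ 2 / (k * h)) * Real.sinh (k * h) ≠ 0)
    (hL : L = (Real.cosh (k * h) - (N ^ 2 / (k * h)) * Real.sinh (k * h))⁻¹)
    (hA : A = (1 / (2 * (1 - N ^ 2))) * L
      * (-h / 2 + Real.sinh (k * h) / k
          - (N ^ 2 / (k ^ 2 * h)) * (Real.cosh (k * h) - 1)))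
    (hB : B = -(L / (2 * (1 - N ^ 2)))
      * (Real.cosh (k * h) / k - (N ^ 2 / (k ^ 2 * h)) * Real.sinh (k * h)))
    (p : ℝ → ℝ) (hp : Differentiable ℝ p)
    (u w : ℝ → ℝ → ℝ)
    (hu : ∀ y1 y3 : ℝ, u y1 y3 =
      ((2 * N ^ 2 / k)
          * (Real.sinh (k * y3) - (y3 / h) * Real.sinh (k * h)) * A
        + (2 * N ^ 2 / k)
            * (Real.cosh (k * y3) - (y3 / h) * (Real.cosh (k * h) - 1) - 1) * B
        + (1 / (2 * (1 - N ^ 2))) * (y3 ^ 2 - y3 * h))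
      * deriv p y1)
    (hw : ∀ y1 y3 : ℝ, w y1 y3 =
      ((Real.cosh (k * y3) - (N ^ 2 / (k * h)) * Real.sinh (k * h)) * A
        + (Real.sinh (k * y3) - (N ^ 2 / (k * h)) * (Real.cosh (k * h) - 1)) * B
        + (1 / (2 * (1 - N ^ 2))) * (y3 - h / 2))
      * deriv p y1) :
    ∀ y1 ∈ Set.Ioo (0 : ℝ) 1, ∀ y3 ∈ Set.Ioo (0 : ℝ) h,
      (-(deriv (deriv (u y1)) y3) + deriv p y1
          + 2 * N ^ 2 * deriv (w y1) y3 = 0)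
      ∧ (-(R_c * deriv (deriv (w y1)) y3) + 4 * N ^ 2 * w y1 y3
          - 2 * N ^ 2 * deriv (u y1) y3 = 0)
      ∧ u y1 h = 0 ∧ w y1 h = 0
      ∧ u y1 0 = 0
      ∧ deriv (w y1) 0 = 0 := by
  have hN : 0 < 1 - N ^ 2 := by nlinarith
  have hN' : 1 - N ^ 2 ≠ 0 := hN.ne'
  have hk0 : k ≠ 0 := by
    rw [hk]
    positivity
  have hk2 : R_c * k ^ 2 = 4 * N ^ 2 * (1 - N ^ 2) := by
    rw [hk, mul_pow, Real.sq_sqrt (by positivity)]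
    field_simp
    ring
  have hc : (1 / (2 * (1 - N ^ 2))) * (1 - N ^ 2) = 1 / 2 := by
    field_simp
  have hLD : L * (Real.cosh (k * h) - (N ^ 2 / (k * h)) * Real.sinh (k * h)) = 1 := by
    rw [hL]
    exact inv_mul_cancel₀ hLden
  have hBk : k * B = -(1 / (2 * (1 - N ^ 2))) := by
    have hexp : k * B = -(1 / (2 * (1 - N ^ 2)))
        * (L * (Real.cosh (k * h) - (N ^ 2 / (k * h)) * Real.sinh (k * h))) := by
      rw [hB]
      field_simp
    rw [hexp, hLD, mul_one]
  have hAD : (Real.cosh (k * h) - (N ^ 2 / (k * h)) * Real.sinh (k * h)) * A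
      = (1 / (2 * (1 - N ^ 2))) * (-h / 2 + Real.sinh (k * h) / k
          - (N ^ 2 / (k ^ 2 * h)) * (Real.cosh (k * h) - 1)) := by
    rw [hA]
    linear_combination (1 / (2 * (1 - N ^ 2))) * (-h / 2 + Real.sinh (k * h) / k
          - (N ^ 2 / (k ^ 2 * h)) * (Real.cosh (k * h) - 1)) * hLD
  have hBval : B = -(1 / (2 * (1 - N ^ 2))) / k := by
    rw [← hBk]
    field_simp
  clear hL hA hB hk
  generalize 1 / (2 * (1 - N ^ 2)) = c at *
  intro y1 _ y3 _
  have hu' : u y1 = fun y => (2 * N ^ 2 / k * A * deriv p y1) * Real.sinh (k * y)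
      + (2 * N ^ 2 / k * B * deriv p y1) * Real.cosh (k * y) + (c * deriv p y1) * y ^ 2
      + ((-(2 * N ^ 2 / k) * (Real.sinh (k * h) * A + (Real.cosh (k * h) - 1) * B) / h - c * h)
          * deriv p y1) * y
      + (-(2 * N ^ 2 / k * B * deriv p y1)) := by
    funext y
    rw [hu]
    ring
  have hw' : w y1 = fun y => (B * deriv p y1) * Real.sinh (k * y)
      + (A * deriv p y1) * Real.cosh (k * y) + 0 * y ^ 2 + (c * deriv p y1) * y
      + (-(N ^ 2 / (k * h)) * (Real.sinh (k * h) * A + (Real.cosh (k * h) - 1) * B) - c * h / 2)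
          * deriv p y1 := by
    funext y
    rw [hw]
    ring
  refine ⟨?_, ?_, ?_, ?_, ?_, ?_⟩
  · rw [hu', hw']
    simp only [deriv_sinh_add_cosh_add_quadratic]
    field_simp
    linear_combination (-2 * deriv p y1) * hc
  · rw [hu', hw']
    simp only [deriv_sinh_add_cosh_add_quadratic]
    field_simp
    linear_combination (-2 * h * k * deriv p y1 * (Real.cosh (k * y3) * A + Real.sinh (k * y3) * B)) * hk2
  · rw [hu, div_self hh.ne']
    ring
  · rw [hw, hAD, hBval]
    field_simp
    ring
  · rw [hu]
    simp
  · rw [hw']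
    simp only [deriv_sinh_add_cosh_add_quadratic]
    simp only [mul_zero, Real.sinh_zero, Real.cosh_zero]
    linear_combination deriv p y1 * hBk
end

section
/- Theorem 4.3 (generalized micropolar Reynolds equation, critical case, alpha different from 1): with the data of the context, define Theta = h^3/(3*(1-N^2)) - (1-eta)*3*h^3/(4*(1-N^2)) - ( (2*N^2/k)*[(cosh(k*h)-1)/k - eta*h*sinh(k*h)] + (gamma/2)*h^2*(1-2*eta) - (1-eta)*[gamma*h + (2*N^2/k)*sinh(k*h)] )*A - ( (2*N^2/k)*[sinh(k*h)/k - eta*h*cosh(k*h)] - (1-eta)*(1+cosh(k*h))*h*N^2/k )*B. Then for every y1 in (0,1), the vertical average of the velocity satisfies: integral for y3 from 0 to h of u(y1, y3) dy3 = -Theta * p'(y1). Consequently, if p is twice differentiable on (0,1) and the incompressibility condition d/dy1 (integral from 0 to h of u(y1,y3) dy3) = S holds on (0,1) for a constant S, then the Reynolds equation -Theta * p''(y1) = S holds on (0,1). -/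
open MeasureTheory intervalIntegral

/-- The integral over `[0, h]` of the micropolar velocity profile. -/
theorem micropolar_profile_integral {k h N : ℝ} (hk : k ≠ 0) (hh : h ≠ 0) (hN : 1 - N ^ 2 ≠ 0)
    {γ η A B : ℝ} :
    (∫ y in (0 : ℝ)..h,
      (((2 * N ^ 2 / k) * (Real.sinh (k * y) - η * Real.sinh (k * h))
          + γ * (y - η * h)
          - (1 - η) * (γ + (2 * N ^ 2 / (k * h)) * Real.sinh (k * h))) * A
        + ((2 * N ^ 2 / k) * (Real.cosh (k * y) - η * Real.cosh (k * h))
            + (1 - η) * (2 * N ^ 2 / k)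
              * (-1 + (y / h) * (1 - Real.cosh (k * h)))) * B
        + (1 / (2 * (1 - N ^ 2)))
            * (y ^ 2 - h ^ 2 + (1 - η) * (y * h + h ^ 2)))) =
      -(h ^ 3 / (3 * (1 - N ^ 2))
        - (1 - η) * (3 * h ^ 3) / (4 * (1 - N ^ 2))
        - ((2 * N ^ 2 / k)
              * ((Real.cosh (k * h) - 1) / k - η * h * Real.sinh (k * h))
            + (γ / 2) * h ^ 2 * (1 - 2 * η)
            - (1 - η) * (γ * h + (2 * N ^ 2 / k) * Real.sinh (k * h))) * A
        - ((2 * N ^ 2 / k)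
              * (Real.sinh (k * h) / k - η * h * Real.cosh (k * h))
            - (1 - η) * (1 + Real.cosh (k * h)) * h * N ^ 2 / k) * B) := by
  have hlin : ∀ y : ℝ, HasDerivAt (fun y => k * y) k y := fun y => by
    simpa using (hasDerivAt_id y).const_mul k
  have hsinh : ∀ y : ℝ, HasDerivAt (fun y => Real.cosh (k * y) / k) (Real.sinh (k * y)) y :=
    fun y => by simpa [hk] using (hlin y).cosh.div_const k
  have hcosh : ∀ y : ℝ, HasDerivAt (fun y => Real.sinh (k * y) / k) (Real.cosh (k * y)) y :=
    fun y => by simpa [hk] using (hlin y).sinh.div_const k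
  have hsq : ∀ y : ℝ, HasDerivAt (fun y : ℝ => y ^ 2 / 2) y y := fun y => by
    simpa using (hasDerivAt_pow 2 y).div_const 2
  have hcube : ∀ y : ℝ, HasDerivAt (fun y : ℝ => y ^ 3 / 3) (y ^ 2) y := fun y => by
    simpa using (hasDerivAt_pow 3 y).div_const 3
  have hconst : ∀ c y : ℝ, HasDerivAt (fun y : ℝ => y * c) c y := fun c y => by
    simpa using (hasDerivAt_id y).mul_const c
  rw [intervalIntegral.integral_eq_sub_of_hasDerivAt
    (fun y _ => (((((((hsinh y).sub (hconst _ y)).const_mul (2 * N ^ 2 / k)).add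
        (((hsq y).sub (hconst _ y)).const_mul γ)).sub (hconst _ y)).mul_const A).add
      (((((hcosh y).sub (hconst _ y)).const_mul (2 * N ^ 2 / k)).add
        (((hconst (-1) y).add (((hsq y).div_const h).mul_const _)).const_mul
          ((1 - η) * (2 * N ^ 2 / k)))).mul_const B)).add
      ((((hcube y).sub (hconst _ y)).add
        ((((hsq y).mul_const h).add (hconst _ y)).const_mul (1 - η))).const_mul
          (1 / (2 * (1 - N ^ 2)))))
    (by apply Continuous.intervalIntegrable; fun_prop)]
  simp only [Pi.add_apply, Pi.sub_apply, mul_zero, Real.cosh_zero, Real.sinh_zero]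
  field_simp
  ring

/-- Theorem 4.3 (generalized micropolar Reynolds equation, critical case,
`α ≠ 1`): the vertical average of the explicit velocity equals `-Θ·p'(y₁)`;
consequently, if `p` is twice differentiable and the incompressibility
condition holds with flux `S`, the Reynolds equation `-Θ·p''(y₁) = S` holds
on `(0,1)`. -/
theorem reynolds_equation_critical_alpha_ne_one
    (N R_c h β α E S : ℝ)
    (hN0 : 0 < N) (hN1 : N < 1) (hRc : 0 < R_c) (hh : 0 < h)
    (hβ : 0 < β) (hα0 : 0 < α) (hα1 : α ≠ 1) (hE : 0 ≤ E)
    (k γ η D L A B Θ : ℝ)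
    (hk : k = 2 * N * Real.sqrt ((1 - N ^ 2) / R_c))
    (hγ : γ = 2 * (1 - α * N ^ 2) / (α - 1))
    (hηden : 1 + (α * h / (α - 1)) * E ≠ 0)
    (hη : η = (1 + (α * h / (α - 1)) * E)⁻¹)
    (hD : D =
      (γ / 2 + Real.cosh (k * h)
          - (1 - η) * (γ / 2 + (N ^ 2 / (k * h)) * Real.sinh (k * h)))
        * (4 * N ^ 4 * η * (1 - Real.cosh (k * h)) + (R_c / β) * k ^ 2)
      + 2 * N ^ 2 * η
        * (Real.sinh (k * h) + (1 - η) * (1 - Real.cosh (k * h)) * N ^ 2 / (k * h))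
        * (γ * k * h + 2 * N ^ 2 * Real.sinh (k * h)))
    (hDne : D ≠ 0)
    (hL : L = -D⁻¹)
    (hA : A = (L / (2 * (1 - N ^ 2)))
      * ((h / 2) * (1 + η)
            * (4 * N ^ 4 * η * (1 - Real.cosh (k * h)) + (R_c / β) * k ^ 2)
        - (k * Real.sinh (k * h)
            + (1 - η) * (1 - Real.cosh (k * h)) * N ^ 2 / h)
          * (R_c / β - 2 * N ^ 2 * h ^ 2 * η)))
    (hB : B = (L / (2 * (1 - N ^ 2)))
      * (N ^ 2 * h * (1 + η) * η * (γ * k * h + 2 * N ^ 2 * Real.sinh (k * h))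
        + k * (R_c / β - 2 * N ^ 2 * h ^ 2 * η)
          * (Real.cosh (k * h) + γ / 2
              - (1 - η) * (γ / 2 + (N ^ 2 / (k * h)) * Real.sinh (k * h)))))
    (hΘ : Θ = h ^ 3 / (3 * (1 - N ^ 2))
      - (1 - η) * (3 * h ^ 3) / (4 * (1 - N ^ 2))
      - ((2 * N ^ 2 / k)
            * ((Real.cosh (k * h) - 1) / k - η * h * Real.sinh (k * h))
          + (γ / 2) * h ^ 2 * (1 - 2 * η)
          - (1 - η) * (γ * h + (2 * N ^ 2 / k) * Real.sinh (k * h))) * A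
      - ((2 * N ^ 2 / k)
            * (Real.sinh (k * h) / k - η * h * Real.cosh (k * h))
          - (1 - η) * (1 + Real.cosh (k * h)) * h * N ^ 2 / k) * B)
    (p : ℝ → ℝ) (hp : Differentiable ℝ p)
    (u : ℝ → ℝ → ℝ)
    (hu : ∀ y1 y3 : ℝ, u y1 y3 =
      (((2 * N ^ 2 / k) * (Real.sinh (k * y3) - η * Real.sinh (k * h))
          + γ * (y3 - η * h)
          - (1 - η) * (γ + (2 * N ^ 2 / (k * h)) * Real.sinh (k * h))) * A
        + ((2 * N ^ 2 / k) * (Real.cosh (k * y3) - η * Real.cosh (k * h))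
            + (1 - η) * (2 * N ^ 2 / k)
              * (-1 + (y3 / h) * (1 - Real.cosh (k * h)))) * B
        + (1 / (2 * (1 - N ^ 2)))
            * (y3 ^ 2 - h ^ 2 + (1 - η) * (y3 * h + h ^ 2)))
      * deriv p y1) :
    (∀ y1 ∈ Set.Ioo (0 : ℝ) 1,
        (∫ y3 in (0 : ℝ)..h, u y1 y3) = -Θ * deriv p y1)
    ∧ ((∀ y1 ∈ Set.Ioo (0 : ℝ) 1, DifferentiableAt ℝ (deriv p) y1) →
        (∀ y1 ∈ Set.Ioo (0 : ℝ) 1,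
          deriv (fun t => ∫ y3 in (0 : ℝ)..h, u t y3) y1 = S) →
        ∀ y1 ∈ Set.Ioo (0 : ℝ) 1, -Θ * deriv (deriv p) y1 = S) := by
  have hk0 : k ≠ 0 := by
    have hN2 : 0 < 1 - N ^ 2 := by nlinarith
    rw [hk]
    positivity
  have hN : 1 - N ^ 2 ≠ 0 := by nlinarith
  have key : ∀ y1 : ℝ, (∫ y3 in (0 : ℝ)..h, u y1 y3) = -Θ * deriv p y1 := by
    intro y1
    simp only [hu, intervalIntegral.integral_mul_const]
    rw [micropolar_profile_integral hk0 hh.ne' hN, hΘ]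
  refine ⟨fun y1 _ => key y1, fun hd hS y1 hy => ?_⟩
  rw [← hS y1 hy, funext key, deriv_const_mul _ (hd y1 hy)]
end

section
/- Theorem 4.3 (generalized micropolar Reynolds equation, critical case, alpha = 1): with the data of the context, define Theta = -(1/(2*(1-N^2)))*(h^3/3 - mu*h^3) - (1-mu)*(h^2/(k*(1-N^2)))*(1-cosh(k*h))/sinh(k*h) - [ (1/(1-N^2))*(h^2/2 - mu*h^2) + (1-mu)*(h/(k*(1-N^2)))*(1-cosh(k*h))/sinh(k*h) ]*A' - [ (2*N^2/k)*(sinh(k*h)/k - mu*h*cosh(k*h)) - (1-mu)*(2*N^2/k)*(h + (1-cosh(k*h))^2/(k*sinh(k*h))) ]*B'. Then for every y1 in (0,1), the vertical average of the velocity satisfies: integral for y3 from 0 to h of u(y1, y3) dy3 = -Theta * p'(y1). Consequently, if p is twice differentiable on (0,1) and d/dy1 (integral from 0 to h of u(y1,y3) dy3) = S holds on (0,1) for a constant S, then -Theta * p''(y1) = S on (0,1). -/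
open MeasureTheory intervalIntegral

/-- The integral over `[0, h]` of a quadratic polynomial plus a combination of `cosh (k y)` and
`sinh (k y)`. -/
theorem integral_cosh_add_sinh_add_quadratic {k : ℝ} (hk : k ≠ 0) (h a b c d e : ℝ) :
    (∫ y in (0 : ℝ)..h,
        (a * Real.cosh (k * y) + b * Real.sinh (k * y) + (c + d * y + e * y ^ 2))) =
      a * (Real.sinh (k * h) / k) + b * ((Real.cosh (k * h) - 1) / k)
        + (c * h + d * (h ^ 2 / 2) + e * (h ^ 3 / 3)) := by
  have hderiv : ∀ y : ℝ, HasDerivAt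
      (fun y => a * (Real.sinh (k * y) / k) + b * (Real.cosh (k * y) / k)
        + (c * y + d * (y ^ 2 / 2) + e * (y ^ 3 / 3)))
      (a * Real.cosh (k * y) + b * Real.sinh (k * y) + (c + d * y + e * y ^ 2)) y := by
    intro y
    have hlin : HasDerivAt (fun y : ℝ => k * y) k y := by
      simpa using (hasDerivAt_id y).const_mul k
    have hpoly := (((hasDerivAt_id y).const_mul c).add
      (((hasDerivAt_pow 2 y).div_const 2).const_mul d)).add
      (((hasDerivAt_pow 3 y).div_const 3).const_mul e)
    refine ((((hlin.sinh.div_const k).const_mul a).add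
      ((hlin.cosh.div_const k).const_mul b)).add hpoly).congr_deriv ?_
    field_simp
    push_cast
    ring
  rw [integral_eq_sub_of_hasDerivAt (fun y _ => hderiv y)
    (Continuous.intervalIntegrable (by fun_prop) 0 h)]
  simp only [mul_zero, Real.sinh_zero, Real.cosh_zero]
  ring

/-- Theorem 4.3 (generalized micropolar Reynolds equation, critical case,
`α = 1`): the vertical average of the explicit velocity equals `-Θ·p'(y₁)`;
consequently, if `p` is twice differentiable and the incompressibility
condition holds with flux `S`, the Reynolds equation `-Θ·p''(y₁) = S` holds
on `(0,1)`.  Here `coth(kh)` is written as `cosh(kh)/sinh(kh)`. -/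
theorem reynolds_equation_critical_alpha_eq_one
    (N R_c h β E S : ℝ)
    (hN0 : 0 < N) (hN1 : N < 1) (hRc : 0 < R_c) (hh : 0 < h)
    (hβ : 0 < β) (hE : 0 ≤ E)
    (k μ D L A B Θ : ℝ)
    (hk : k = 2 * N * Real.sqrt ((1 - N ^ 2) / R_c))
    (hμden : 1 - (N ^ 2 / (1 - N ^ 2)) * (Real.sinh (k * h) / k) * E ≠ 0)
    (hμ : μ = (1 - (N ^ 2 / (1 - N ^ 2)) * (Real.sinh (k * h) / k) * E)⁻¹)
    (hD : D =
      (1 - (1 - μ) * (Real.cosh (k * h) / Real.sinh (k * h)) * (h * k / N ^ 2))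
        * (4 * N ^ 4 * μ * (1 - Real.cosh (k * h)) + (R_c / β) * k ^ 2)
      + 4 * N ^ 2 * h * k * μ
        * (Real.sinh (k * h)
            + (1 - μ) * (Real.cosh (k * h) / Real.sinh (k * h))
              * (1 - Real.cosh (k * h))))
    (hDne : D ≠ 0)
    (hL : L = -D⁻¹)
    (hA : A = L *
      ((4 * N ^ 4 * μ * (1 - Real.cosh (k * h)) + (R_c / β) * k ^ 2)
          * (h - (1 - μ) * (Real.cosh (k * h) / Real.sinh (k * h))
              * (h ^ 2 * k / (2 * N ^ 2)))
        - k * (Real.sinh (k * h)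
            + (1 - μ) * (Real.cosh (k * h) / Real.sinh (k * h))
              * (1 - Real.cosh (k * h)))
          * (R_c / β - 2 * N ^ 2 * h ^ 2 * μ)))
    (hB : B = k * (L / (2 * (1 - N ^ 2)))
      * (2 * N ^ 2 * h ^ 2 * μ + R_c / β
        - (1 - μ) * (Real.cosh (k * h) / Real.sinh (k * h))
          * (h * k / N ^ 2) * (R_c / β)))
    (hΘ : Θ = -(1 / (2 * (1 - N ^ 2))) * (h ^ 3 / 3 - μ * h ^ 3)
      - (1 - μ) * (h ^ 2 / (k * (1 - N ^ 2)))
          * ((1 - Real.cosh (k * h)) / Real.sinh (k * h))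
      - ((1 / (1 - N ^ 2)) * (h ^ 2 / 2 - μ * h ^ 2)
          + (1 - μ) * (h / (k * (1 - N ^ 2)))
              * ((1 - Real.cosh (k * h)) / Real.sinh (k * h))) * A
      - ((2 * N ^ 2 / k)
            * (Real.sinh (k * h) / k - μ * h * Real.cosh (k * h))
          - (1 - μ) * (2 * N ^ 2 / k)
              * (h + (1 - Real.cosh (k * h)) ^ 2 / (k * Real.sinh (k * h)))) * B)
    (p : ℝ → ℝ) (hp : Differentiable ℝ p)
    (u : ℝ → ℝ → ℝ)
    (hu : ∀ y1 y3 : ℝ, u y1 y3 =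
      (((2 * N ^ 2 / k) * (Real.cosh (k * y3) - μ * Real.cosh (k * h))
          - (1 - μ) * (2 * N ^ 2 / k)
            * (1 - (1 - Real.cosh (k * h))
                * Real.sinh (k * y3) / Real.sinh (k * h))) * B
        + (1 / (2 * (1 - N ^ 2))) * (y3 ^ 2 - μ * h ^ 2)
        - (1 - μ) * (h ^ 2 / (1 - N ^ 2))
            * Real.sinh (k * y3) / Real.sinh (k * h)
        + ((1 / (1 - N ^ 2)) * (y3 - μ * h)
            - (1 - μ) * (h / (1 - N ^ 2))
                * Real.sinh (k * y3) / Real.sinh (k * h)) * A)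
      * deriv p y1) :
    (∀ y1 ∈ Set.Ioo (0 : ℝ) 1,
        (∫ y3 in (0 : ℝ)..h, u y1 y3) = -Θ * deriv p y1)
    ∧ ((∀ y1 ∈ Set.Ioo (0 : ℝ) 1, DifferentiableAt ℝ (deriv p) y1) →
        (∀ y1 ∈ Set.Ioo (0 : ℝ) 1,
          deriv (fun t => ∫ y3 in (0 : ℝ)..h, u t y3) y1 = S) →
        ∀ y1 ∈ Set.Ioo (0 : ℝ) 1, -Θ * deriv (deriv p) y1 = S) := by
  have hN : 0 < 1 - N ^ 2 := by nlinarith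
  have hk0 : k ≠ 0 := by
    rw [hk]
    positivity
  have hflux : ∀ y1, (∫ y3 in (0 : ℝ)..h, u y1 y3) = -Θ * deriv p y1 := by
    intro y1
    simp only [hu, intervalIntegral.integral_mul_const]
    congr 1
    rw [hΘ]
    refine Eq.trans (intervalIntegral.integral_congr fun y _ => ?_)
      ((integral_cosh_add_sinh_add_quadratic hk0 h
        (2 * N ^ 2 / k * B)
        ((1 - μ) * (2 * N ^ 2 / k * (1 - Real.cosh (k * h)) * B
          - h ^ 2 / (1 - N ^ 2) - h / (1 - N ^ 2) * A) / Real.sinh (k * h))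
        (-(2 * N ^ 2 / k) * (μ * Real.cosh (k * h) + (1 - μ)) * B
          - 1 / (2 * (1 - N ^ 2)) * (μ * h ^ 2) - 1 / (1 - N ^ 2) * (μ * h) * A)
        (1 / (1 - N ^ 2) * A) (1 / (2 * (1 - N ^ 2)))).trans ?_)
    · ring
    · generalize 1 - N ^ 2 = M
      ring
  refine ⟨fun y1 _ => hflux y1, fun hp' hS y1 hy1 => ?_⟩
  rw [← hS y1 hy1, funext hflux, deriv_const_mul _ (hp' y1 hy1)]
end

section
/- Theorem 4.4 (generalized micropolar Reynolds equation, super-critical case): with the data of the context, define Theta = h^3/(12*(1-N^2)) - (2*N^2/k)*[(cosh(k*h)-1)/k - (h/2)*sinh(k*h)]*A'' - (2*N^2/k)*[sinh(k*h)/k - (h/2)*(cosh(k*h)+1)]*B''. Then for every y1 in (0,1), the vertical average of the velocity satisfies: integral for y3 from 0 to h of u(y1, y3) dy3 = -Theta * p'(y1). Consequently, if p is twice differentiable on (0,1) and d/dy1 (integral from 0 to h of u(y1,y3) dy3) = S holds on (0,1) for a constant S, then -Theta * p''(y1) = S on (0,1). -/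
open MeasureTheory intervalIntegral

/-- Integral over `[0, h]` of the velocity profile obtained by superposing the hyperbolic modes
(with amplitudes `A`, `B`, corrected to vanish at `0`) and a parabola vanishing at `0` and `h`. -/
theorem integral_hyperbolic_profile {k h : ℝ} (hk : k ≠ 0) (hh : h ≠ 0) (c d A B : ℝ) :
    (∫ y in (0 : ℝ)..h,
        (c * (Real.sinh (k * y) - (y / h) * Real.sinh (k * h)) * A
          + c * (Real.cosh (k * y) - (y / h) * (Real.cosh (k * h) - 1) - 1) * B
          + d * (y ^ 2 - y * h)))
      = c * ((Real.cosh (k * h) - 1) / k - (h / 2) * Real.sinh (k * h)) * A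
        + c * (Real.sinh (k * h) / k - (h / 2) * (Real.cosh (k * h) + 1)) * B
        - d * (h ^ 3 / 6) := by
  have hderiv : ∀ y ∈ Set.uIcc (0 : ℝ) h, HasDerivAt (fun y : ℝ =>
      c * (Real.cosh (k * y) / k - (y ^ 2 / (2 * h)) * Real.sinh (k * h)) * A
        + c * (Real.sinh (k * y) / k - (y ^ 2 / (2 * h)) * (Real.cosh (k * h) - 1) - y) * B
        + d * (y ^ 3 / 3 - y ^ 2 / 2 * h))
      (c * (Real.sinh (k * y) - (y / h) * Real.sinh (k * h)) * A
        + c * (Real.cosh (k * y) - (y / h) * (Real.cosh (k * h) - 1) - 1) * B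
        + d * (y ^ 2 - y * h)) y := by
    intro y _
    have hky : HasDerivAt (fun y : ℝ => k * y) k y := by
      simpa using (hasDerivAt_id y).const_mul k
    have hsq : HasDerivAt (fun y : ℝ => y ^ 2) (2 * y) y := by
      simpa using hasDerivAt_pow 2 y
    have hcube : HasDerivAt (fun y : ℝ => y ^ 3) (3 * y ^ 2) y := by
      simpa using hasDerivAt_pow 3 y
    have hsinh := (((hky.cosh.div_const k).sub
      ((hsq.div_const (2 * h)).mul_const (Real.sinh (k * h)))).const_mul c).mul_const A
    have hcosh := ((((hky.sinh.div_const k).sub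
      ((hsq.div_const (2 * h)).mul_const (Real.cosh (k * h) - 1))).sub
        (hasDerivAt_id y)).const_mul c).mul_const B
    have hpoly := ((hcube.div_const 3).sub ((hsq.div_const 2).mul_const h)).const_mul d
    refine ((hsinh.add hcosh).add hpoly).congr_deriv ?_
    field_simp
  rw [integral_eq_sub_of_hasDerivAt hderiv (Continuous.intervalIntegrable (by fun_prop) _ _)]
  simp only [mul_zero, Real.cosh_zero, Real.sinh_zero]
  field_simp
  ring

/-- Theorem 4.4 (generalized micropolar Reynolds equation, super-critical
case): the vertical average of the explicit velocity equals `-Θ·p'(y₁)`;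
consequently, if `p` is twice differentiable and the incompressibility
condition holds with flux `S`, the Reynolds equation `-Θ·p''(y₁) = S` holds
on `(0,1)`. -/
theorem reynolds_equation_supercritical
    (N R_c h S : ℝ)
    (hN0 : 0 < N) (hN1 : N < 1) (hRc : 0 < R_c) (hh : 0 < h)
    (k L A B Θ : ℝ)
    (hk : k = 2 * N * Real.sqrt ((1 - N ^ 2) / R_c))
    (hLden : Real.cosh (k * h) - (N ^ 2 / (k * h)) * Real.sinh (k * h) ≠ 0)
    (hL : L = (Real.cosh (k * h) - (N ^ 2 / (k * h)) * Real.sinh (k * h))⁻¹)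
    (hA : A = (1 / (2 * (1 - N ^ 2))) * L
      * (-h / 2 + Real.sinh (k * h) / k
          - (N ^ 2 / (k ^ 2 * h)) * (Real.cosh (k * h) - 1)))
    (hB : B = -(L / (2 * (1 - N ^ 2)))
      * (Real.cosh (k * h) / k - (N ^ 2 / (k ^ 2 * h)) * Real.sinh (k * h)))
    (hΘ : Θ = h ^ 3 / (12 * (1 - N ^ 2))
      - (2 * N ^ 2 / k)
          * ((Real.cosh (k * h) - 1) / k - (h / 2) * Real.sinh (k * h)) * A
      - (2 * N ^ 2 / k)
          * (Real.sinh (k * h) / k - (h / 2) * (Real.cosh (k * h) + 1)) * B)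
    (p : ℝ → ℝ) (hp : Differentiable ℝ p)
    (u : ℝ → ℝ → ℝ)
    (hu : ∀ y1 y3 : ℝ, u y1 y3 =
      ((2 * N ^ 2 / k)
          * (Real.sinh (k * y3) - (y3 / h) * Real.sinh (k * h)) * A
        + (2 * N ^ 2 / k)
            * (Real.cosh (k * y3) - (y3 / h) * (Real.cosh (k * h) - 1) - 1) * B
        + (1 / (2 * (1 - N ^ 2))) * (y3 ^ 2 - y3 * h))
      * deriv p y1) :
    (∀ y1 ∈ Set.Ioo (0 : ℝ) 1,
        (∫ y3 in (0 : ℝ)..h, u y1 y3) = -Θ * deriv p y1)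
    ∧ ((∀ y1 ∈ Set.Ioo (0 : ℝ) 1, DifferentiableAt ℝ (deriv p) y1) →
        (∀ y1 ∈ Set.Ioo (0 : ℝ) 1,
          deriv (fun t => ∫ y3 in (0 : ℝ)..h, u t y3) y1 = S) →
        ∀ y1 ∈ Set.Ioo (0 : ℝ) 1, -Θ * deriv (deriv p) y1 = S) := by
  have hN : 0 < 1 - N ^ 2 := by nlinarith
  have hk0 : k ≠ 0 := by
    rw [hk]
    positivity
  have hflux : ∀ y1 : ℝ, (∫ y3 in (0 : ℝ)..h, u y1 y3) = -Θ * deriv p y1 := by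
    intro y1
    simp only [hu]
    rw [intervalIntegral.integral_mul_const, integral_hyperbolic_profile hk0 hh.ne', hΘ]
    have hN' := hN.ne'
    congr 1
    field_simp
    ring
  refine ⟨fun y1 _ => hflux y1, fun hp2 hS y1 hy1 => ?_⟩
  rw [← hS y1 hy1]
  simp only [hflux]
  exact (deriv_const_mul (-Θ) (hp2 y1 hy1)).symm
end

section
/- Corollary A.1 (second-order development of the Reynolds coefficient in the roughness amplitude, case alpha = 1): with the notation of the context, write ch = cosh(k*h), sh = sinh(k*h), and define A'0 = h*[4*N^4*(1-ch) + (R_c/beta)*k^2] - k*sh*[R_c/beta - 2*N^2*h^2]; A'1 = h*[4*N^4*(1-ch) + 2*N^2*h*k*sh] + (R_c/beta)*k*coth(k*h)*[1 - ch + k^2*h^2/(2*N^2)]; B'0 = 2*N^2*h^2 + R_c/beta; B'1 = 2*N^2*h^2 + coth(k*h)*(h*k/N^2)*(R_c/beta); L'0 = (4*N^4*(1-ch) + (R_c/beta)*k^2 + 4*N^2*h*k*sh)^(-1); L'1 = 4*N^4*(1-ch) + coth(k*h)*(k^3*h/N^2)*(R_c/beta) + 4*k*h*N^2*sh. Define Theta0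 = h^3/(3*(1-N^2)) - (h^2/(2*(1-N^2)))*L'0*A'0 + (N^2/(1-N^2))*(sh/k - h*ch)*L'0*B'0 and Theta1 = -(h^2/(1-N^2))*(h/2 + (1-ch)/(k*sh)) + (h^2/(2*(1-N^2)))*L'0*(A'1 - L'0*L'1*A'0) + (h/(1-N^2))*(h + (1-ch)/(k*sh))*L'0*A'0 - (N^2/(1-N^2))*(sh/k - h*ch)*L'0*(B'1 - L'0*L'1*B'0) - (N^2/(1-N^2))*(-h*ch + h + (1-ch)^2/(k*sh))*L'0*B'0. Then there exist delta0 > 0 and C > 0 such that for every real lambda with 0 < |lambda| < delta0, the coefficient Theta_lambda is well defined and satisfies |Theta_lambda - Theta0 + C_N*E*lambda^2*Theta1| <= C*lambda^4, i.e. Theta_lambda = Theta0 - C_N*E*lambda^2*Theta1 + O(lambda^4) as lambda -> 0. -/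
open Filter Topology Asymptotics

/-- `f` agrees with `a + b * s` up to an error of order `s ^ 2` along the filter `l`. -/
def IsFirstOrder {α : Type*} (l : Filter α) (s f : α → ℝ) (a b : ℝ) : Prop :=
  (fun x => f x - (a + b * s x)) =O[l] fun x => s x ^ 2

namespace IsFirstOrder

variable {α : Type*} {l : Filter α} {s f g : α → ℝ} {a b c d : ℝ}

theorem congr_coeff (hf : IsFirstOrder l s f a b) (ha : a = c) (hb : b = d) :
    IsFirstOrder l s f c d := ha ▸ hb ▸ hf

theorem const (l : Filter α) (s : α → ℝ) (a : ℝ) : IsFirstOrder l s (fun _ => a) a 0 := by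
  simp [IsFirstOrder, isBigO_zero]

theorem self (l : Filter α) (s : α → ℝ) : IsFirstOrder l s s 0 1 := by
  simp [IsFirstOrder, isBigO_zero]

theorem add (hf : IsFirstOrder l s f a b) (hg : IsFirstOrder l s g c d) :
    IsFirstOrder l s (fun x => f x + g x) (a + c) (b + d) :=
  (IsBigO.add hf hg).congr_left fun x => by ring

theorem neg (hf : IsFirstOrder l s f a b) : IsFirstOrder l s (fun x => -f x) (-a) (-b) :=
  (IsBigO.neg_left hf).congr_left fun x => by ring

theorem sub (hf : IsFirstOrder l s f a b) (hg : IsFirstOrder l s g c d) :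
    IsFirstOrder l s (fun x => f x - g x) (a - c) (b - d) :=
  (IsBigO.sub hf hg).congr_left fun x => by ring

theorem tendsto (hf : IsFirstOrder l s f a b) (hs : Tendsto s l (𝓝 0)) :
    Tendsto f l (𝓝 a) := by
  have h0 : Tendsto (fun x => s x ^ 2) l (𝓝 0) := by simpa using hs.pow 2
  have h1 := (IsBigO.trans_tendsto hf h0).add ((hs.const_mul b).const_add a)
  simpa using h1

theorem mul (hf : IsFirstOrder l s f a b) (hg : IsFirstOrder l s g c d)
    (hs : Tendsto s l (𝓝 0)) :
    IsFirstOrder l s (fun x => f x * g x) (a * c) (a * d + b * c) := by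
  have h1 : (fun x => (f x - (a + b * s x)) * g x) =O[l] fun x => s x ^ 2 := by
    simpa using IsBigO.mul hf ((hg.tendsto hs).isBigO_one ℝ)
  have h2 : (fun x => (a + b * s x) * (g x - (c + d * s x))) =O[l] fun x => s x ^ 2 := by
    simpa using (((hs.const_mul b).const_add a).isBigO_one ℝ).mul hg
  have h3 : (fun x => b * d * s x ^ 2) =O[l] fun x => s x ^ 2 :=
    (isBigO_refl _ l).const_mul_left _
  exact ((h1.add h2).add h3).congr_left fun x => by ring

theorem inv (hf : IsFirstOrder l s f a b) (ha : a ≠ 0) (hs : Tendsto s l (𝓝 0)) :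
    IsFirstOrder l s (fun x => (f x)⁻¹) a⁻¹ (-(a⁻¹ * a⁻¹ * b)) := by
  have hlim := hf.tendsto hs
  have h1 : IsFirstOrder l s (fun x => a * a + f x * (b * s x - a)) 0 0 :=
    ((const l s (a * a)).add (hf.mul
      (((const l s b).mul (self l s) hs).sub (const l s a)) hs)).congr_coeff (by ring) (by ring)
  have h2 : (fun x => a * a + f x * (b * s x - a)) =O[l] fun x => s x ^ 2 :=
    IsBigO.congr_left h1 fun x => by ring
  have h3 : (fun x => (a * a + f x * (b * s x - a)) * ((f x)⁻¹ * (a⁻¹ * a⁻¹)))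
      =O[l] fun x => s x ^ 2 := by
    simpa using h2.mul (((hlim.inv₀ ha).mul_const (a⁻¹ * a⁻¹)).isBigO_one ℝ)
  refine h3.congr' ?_ EventuallyEq.rfl
  filter_upwards [hlim.eventually_ne ha] with x hx
  field_simp
  ring

end IsFirstOrder


/-- Corollary A.1 (case `α = 1`): second-order development of the Reynolds
coefficient `Θ_λ` in the roughness amplitude `λ`:
`Θ_λ = Θ₀ - C_N·E·λ²·Θ₁ + O(λ⁴)` as `λ → 0`, the coefficient being well
defined (all denominators nonzero) for `λ` small enough.  Here `coth(kh)` is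
written as `cosh(kh)/sinh(kh)`. -/
theorem reynolds_coefficient_expansion_alpha_eq_one
    (N R_c h β E : ℝ)
    (hN0 : 0 < N) (hN1 : N < 1) (hRc : 0 < R_c) (hh : 0 < h)
    (hβ : 0 < β) (hE : 0 ≤ E)
    (k CN ch sh : ℝ)
    (hk : k = 2 * N * Real.sqrt ((1 - N ^ 2) / R_c))
    (hch : ch = Real.cosh (k * h)) (hsh : sh = Real.sinh (k * h))
    (hCN : CN = (N ^ 2 / (1 - N ^ 2)) * (sh / k))
    (μf Df Lf Af Bf Θf : ℝ → ℝ)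
    (hμf : ∀ lam : ℝ, μf lam = (1 - CN * E * lam ^ 2)⁻¹)
    (hDf : ∀ lam : ℝ, Df lam =
      (1 - (1 - μf lam) * (ch / sh) * (h * k / N ^ 2))
        * (4 * N ^ 4 * μf lam * (1 - ch) + (R_c / β) * k ^ 2)
      + 4 * N ^ 2 * h * k * μf lam
        * (sh + (1 - μf lam) * (ch / sh) * (1 - ch)))
    (hLf : ∀ lam : ℝ, Lf lam = -(Df lam)⁻¹)
    (hAf : ∀ lam : ℝ, Af lam = Lf lam *
      ((4 * N ^ 4 * μf lam * (1 - ch) + (R_c / β) * k ^ 2)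
          * (h - (1 - μf lam) * (ch / sh) * (h ^ 2 * k / (2 * N ^ 2)))
        - k * (sh + (1 - μf lam) * (ch / sh) * (1 - ch))
          * (R_c / β - 2 * N ^ 2 * h ^ 2 * μf lam)))
    (hBf : ∀ lam : ℝ, Bf lam = k * (Lf lam / (2 * (1 - N ^ 2)))
      * (2 * N ^ 2 * h ^ 2 * μf lam + R_c / β
        - (1 - μf lam) * (ch / sh) * (h * k / N ^ 2) * (R_c / β)))
    (hΘf : ∀ lam : ℝ, Θf lam =
      -(1 / (2 * (1 - N ^ 2))) * (h ^ 3 / 3 - μf lam * h ^ 3)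
      - (1 - μf lam) * (h ^ 2 / (k * (1 - N ^ 2))) * ((1 - ch) / sh)
      - ((1 / (1 - N ^ 2)) * (h ^ 2 / 2 - μf lam * h ^ 2)
          + (1 - μf lam) * (h / (k * (1 - N ^ 2))) * ((1 - ch) / sh)) * Af lam
      - ((2 * N ^ 2 / k) * (sh / k - μf lam * h * ch)
          - (1 - μf lam) * (2 * N ^ 2 / k)
              * (h + (1 - ch) ^ 2 / (k * sh))) * Bf lam)
    (A0 A1 B0 B1 L0 L1 Θ0 Θ1 : ℝ)
    (hA0 : A0 = h * (4 * N ^ 4 * (1 - ch) + (R_c / β) * k ^ 2)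
      - k * sh * (R_c / β - 2 * N ^ 2 * h ^ 2))
    (hA1 : A1 = h * (4 * N ^ 4 * (1 - ch) + 2 * N ^ 2 * h * k * sh)
      + (R_c / β) * k * (ch / sh) * (1 - ch + k ^ 2 * h ^ 2 / (2 * N ^ 2)))
    (hB0 : B0 = 2 * N ^ 2 * h ^ 2 + R_c / β)
    (hB1 : B1 = 2 * N ^ 2 * h ^ 2 + (ch / sh) * (h * k / N ^ 2) * (R_c / β))
    (hL0den : 4 * N ^ 4 * (1 - ch) + (R_c / β) * k ^ 2
      + 4 * N ^ 2 * h * k * sh ≠ 0)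
    (hL0 : L0 = (4 * N ^ 4 * (1 - ch) + (R_c / β) * k ^ 2
      + 4 * N ^ 2 * h * k * sh)⁻¹)
    (hL1 : L1 = 4 * N ^ 4 * (1 - ch)
      + (ch / sh) * (k ^ 3 * h / N ^ 2) * (R_c / β)
      + 4 * k * h * N ^ 2 * sh)
    (hΘ0 : Θ0 = h ^ 3 / (3 * (1 - N ^ 2))
      - (h ^ 2 / (2 * (1 - N ^ 2))) * L0 * A0
      + (N ^ 2 / (1 - N ^ 2)) * (sh / k - h * ch) * L0 * B0)
    (hΘ1 : Θ1 = -(h ^ 2 / (1 - N ^ 2)) * (h / 2 + (1 - ch) / (k * sh))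
      + (h ^ 2 / (2 * (1 - N ^ 2))) * L0 * (A1 - L0 * L1 * A0)
      + (h / (1 - N ^ 2)) * (h + (1 - ch) / (k * sh)) * L0 * A0
      - (N ^ 2 / (1 - N ^ 2)) * (sh / k - h * ch) * L0 * (B1 - L0 * L1 * B0)
      - (N ^ 2 / (1 - N ^ 2)) * (-h * ch + h + (1 - ch) ^ 2 / (k * sh))
          * L0 * B0) :
    ∃ δ₀ > (0 : ℝ), ∃ C > (0 : ℝ), ∀ lam : ℝ, 0 < |lam| → |lam| < δ₀ →
      (1 - CN * E * lam ^ 2 ≠ 0 ∧ Df lam ≠ 0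
        ∧ |Θf lam - Θ0 + CN * E * lam ^ 2 * Θ1| ≤ C * lam ^ 4) := by
  have hNe : N ≠ 0 := hN0.ne'
  have hM : 0 < 1 - N ^ 2 := by nlinarith
  have hMe : 1 - N ^ 2 ≠ 0 := hM.ne'
  have hke : k ≠ 0 := by
    have : 0 < Real.sqrt ((1 - N ^ 2) / R_c) := Real.sqrt_pos.mpr (div_pos hM hRc)
    rw [hk]
    positivity
  have hshe : sh ≠ 0 := by
    rw [hsh, Ne, Real.sinh_eq_zero]
    exact mul_ne_zero hke hh.ne'
  set s : ℝ → ℝ := fun lam => CN * E * lam ^ 2 with hsdef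
  have hs : Tendsto s (𝓝 0) (𝓝 0) := by
    have : Continuous s := by fun_prop
    simpa [hsdef] using this.tendsto 0
  have hconst : ∀ a : ℝ, IsFirstOrder (𝓝 0) s (fun _ => a) a 0 := IsFirstOrder.const (𝓝 0) s
  have hμ : IsFirstOrder (𝓝 0) s μf 1 1 := by
    rw [funext hμf]
    exact (((hconst 1).sub (IsFirstOrder.self _ s)).inv (by norm_num) hs).congr_coeff
      (by norm_num) (by norm_num)
  have hν : IsFirstOrder (𝓝 0) s (fun lam => 1 - μf lam) 0 (-1) :=
    ((hconst 1).sub hμ).congr_coeff (by norm_num) (by norm_num)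
  have hcoth := hν.mul (hconst (ch / sh)) hs
  have hP := (((hconst (4 * N ^ 4)).mul hμ hs).mul (hconst (1 - ch)) hs).add
    (hconst ((R_c / β) * k ^ 2))
  have hQ := (hconst sh).add (hcoth.mul (hconst (1 - ch)) hs)
  have hD : IsFirstOrder (𝓝 0) s Df
      (4 * N ^ 4 * (1 - ch) + (R_c / β) * k ^ 2 + 4 * N ^ 2 * h * k * sh) L1 := by
    rw [funext hDf]
    refine ((((hconst 1).sub (hcoth.mul (hconst (h * k / N ^ 2)) hs)).mul hP hs).add
      (((hconst (4 * N ^ 2 * h * k)).mul hμ hs).mul hQ hs)).congr_coeff ?_ ?_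
    · ring
    · rw [hL1]
      field_simp
      ring
  have hL : IsFirstOrder (𝓝 0) s Lf (-L0) (L0 * L0 * L1) := by
    rw [funext hLf, hL0]
    exact (hD.inv hL0den hs).neg.congr_coeff rfl (by ring)
  have hA : IsFirstOrder (𝓝 0) s Af (-(L0 * A0)) (-(L0 * (A1 - L0 * L1 * A0))) := by
    rw [funext hAf]
    have hbr := ((hP.mul ((hconst h).sub
        (hcoth.mul (hconst (h ^ 2 * k / (2 * N ^ 2))) hs)) hs).sub
        (((hconst k).mul hQ hs).mul
          ((hconst (R_c / β)).sub ((hconst (2 * N ^ 2 * h ^ 2)).mul hμ hs)) hs)).congr_coeff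
        (c := A0) (d := A1) (by rw [hA0]; ring) (by rw [hA1]; field_simp; ring)
    exact (hL.mul hbr hs).congr_coeff (by ring) (by ring)
  have hB : IsFirstOrder (𝓝 0) s Bf (-(k / (2 * (1 - N ^ 2)) * (L0 * B0)))
      (-(k / (2 * (1 - N ^ 2)) * (L0 * (B1 - L0 * L1 * B0)))) := by
    rw [funext hBf]
    have hbr := ((((hconst (2 * N ^ 2 * h ^ 2)).mul hμ hs).add (hconst (R_c / β))).sub
        ((hcoth.mul (hconst (h * k / N ^ 2)) hs).mul (hconst (R_c / β)) hs)).congr_coeff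
        (c := B0) (d := B1) (by rw [hB0]; ring) (by rw [hB1]; ring)
    simp only [div_eq_mul_inv]
    simp only [div_eq_mul_inv] at hbr
    exact (((hconst k).mul (hL.mul (hconst (2 * (1 - N ^ 2))⁻¹) hs) hs).mul hbr hs).congr_coeff
      (by ring) (by ring)
  have hΘ : IsFirstOrder (𝓝 0) s Θf Θ0 (-Θ1) := by
    rw [funext hΘf]
    have hcA := ((hconst (1 / (1 - N ^ 2))).mul
        ((hconst (h ^ 2 / 2)).sub (hμ.mul (hconst (h ^ 2)) hs)) hs).add
        ((hν.mul (hconst (h / (k * (1 - N ^ 2)))) hs).mul (hconst ((1 - ch) / sh)) hs)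
    have hcB := ((hconst (2 * N ^ 2 / k)).mul
        ((hconst (sh / k)).sub ((hμ.mul (hconst h) hs).mul (hconst ch) hs)) hs).sub
        ((hν.mul (hconst (2 * N ^ 2 / k)) hs).mul
          (hconst (h + (1 - ch) ^ 2 / (k * sh))) hs)
    have hfree := ((hconst (-(1 / (2 * (1 - N ^ 2))))).mul
        ((hconst (h ^ 3 / 3)).sub (hμ.mul (hconst (h ^ 3)) hs)) hs).sub
        ((hν.mul (hconst (h ^ 2 / (k * (1 - N ^ 2)))) hs).mul (hconst ((1 - ch) / sh)) hs)
    refine ((hfree.sub (hcA.mul hA hs)).sub (hcB.mul hB hs)).congr_coeff ?_ ?_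
    · rw [hΘ0]
      clear * - hNe hMe hke hshe
      field_simp
      ring
    · rw [hΘ1]
      clear * - hNe hMe hke hshe
      field_simp
      ring
  have hmain : (fun lam => Θf lam - (Θ0 + -Θ1 * s lam)) =O[𝓝 0] fun lam : ℝ => lam ^ 4 :=
    IsBigO.trans hΘ (((isBigO_refl (fun lam : ℝ => lam ^ 4) (𝓝 0)).const_mul_left
      ((CN * E) ^ 2)).congr_left fun lam => by simp only [hsdef]; ring)
  obtain ⟨C, hC, hbound⟩ := hmain.exists_pos
  have hden : ∀ᶠ lam in 𝓝 (0 : ℝ), 1 - s lam ≠ 0 := by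
    have : Tendsto (fun lam => 1 - s lam) (𝓝 0) (𝓝 1) := by simpa using hs.const_sub 1
    exact this.eventually_ne one_ne_zero
  obtain ⟨δ, hδ, hball⟩ := Metric.eventually_nhds_iff.mp
    (hden.and (((hD.tendsto hs).eventually_ne hL0den).and hbound.bound))
  refine ⟨δ, hδ, C, hC, fun lam _ hlam => ?_⟩
  obtain ⟨h1, h2, h3⟩ := hball (by simpa using hlam : dist lam 0 < δ)
  refine ⟨h1, h2, ?_⟩
  have h4 : (0 : ℝ) ≤ lam ^ 4 := by positivity
  rw [Real.norm_eq_abs, Real.norm_of_nonneg h4] at h3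
  convert h3 using 2
  simp only [hsdef]
  ring
end
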